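/- Let A be a minimal WFA with n states computing f ∈ ℓ²(Σ) whose Hankel matrix H_f has singular values σ₁ ≥ ⋯ ≥ σ_n > 0. For 1 ≤ n̂ < n, let f̂ be the function computed by the truncation Â = Γ A' Γᵀ of an SVA A' for f to its first n̂ states. Then Σ_{x∈Σ*} (f(x) − f̂(x))² ≤ Σ_{i=n̂+1}^n σ_i². -/

import Mathlib

open scoped ENNReal
open scoped Kronecker
open Matrix

noncomputable section

/-- A weighted finite automaton of dimension `n` over alphabet `S`,
with initial weights, final weights and transition matrices. -/
structure WFA (S : Type*) (n : ℕ) where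
  init : Fin n → ℝ
  final : Fin n → ℝ
  trans : S → Matrix (Fin n) (Fin n) ℝ

namespace WFA

variable {S : Type*} {n : ℕ}

/-- `A_x = A_{x₁} ⋯ A_{x_t}` (identity for the empty string). -/
def matOf (M : WFA S n) (x : List S) : Matrix (Fin n) (Fin n) ℝ :=
  (x.map M.trans).prod

/-- The function computed by the WFA: `f_A(x) = αᵀ A_x β`. -/
def f (M : WFA S n) (x : List S) : ℝ :=
  M.init ⬝ᵥ (M.matOf x).mulVec M.final

/-- Row `p` of the forward matrix: `αᵀ A_p`. -/
def fwd (M : WFA S n) (x : List S) : Fin n → ℝ :=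
  Matrix.vecMul M.init (M.matOf x)

/-- Row `s` of the backward matrix: `(A_s β)ᵀ`. -/
def bwd (M : WFA S n) (x : List S) : Fin n → ℝ :=
  (M.matOf x).mulVec M.final

/-- `M` is a minimal WFA: no WFA of strictly smaller dimension computes the same function. -/
def Min (M : WFA S n) : Prop :=
  ∀ m : ℕ, (∃ B : WFA S m, B.f = M.f) → n ≤ m

/-- The reachability Gramian `G_p = Pᵀ P` is well-defined: all its defining sums converge. -/
def GpDefined (M : WFA S n) : Prop :=
  ∀ i j, Summable fun x : List S => M.fwd x i * M.fwd x j

/-- The observability Gramian `G_s = Sᵀ S` is well-defined: all its defining sums converge. -/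
def GsDefined (M : WFA S n) : Prop :=
  ∀ i j, Summable fun x : List S => M.bwd x i * M.bwd x j

/-- The reachability Gramian `G_p = Pᵀ P`. -/
def Gp (M : WFA S n) : Matrix (Fin n) (Fin n) ℝ :=
  Matrix.of fun i j => ∑' x : List S, M.fwd x i * M.fwd x j

/-- The observability Gramian `G_s = Sᵀ S`. -/
def Gs (M : WFA S n) : Matrix (Fin n) (Fin n) ℝ :=
  Matrix.of fun i j => ∑' x : List S, M.bwd x i * M.bwd x j

/-- Truncation of a WFA to its first `m` states. -/
def trunc (M : WFA S n) (m : ℕ) (h : m ≤ n) : WFA S m where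
  init := fun i => M.init (Fin.castLE h i)
  final := fun i => M.final (Fin.castLE h i)
  trans := fun a => Matrix.of fun i j => M.trans a (Fin.castLE h i) (Fin.castLE h j)

end WFA

/-- A function `f : Σ* → ℝ` is rational if it is computed by some WFA. -/
def IsRational {S : Type*} (f : List S → ℝ) : Prop :=
  ∃ (n : ℕ) (M : WFA S n), M.f = f

/-- Spectral radius of a real square matrix: the largest modulus of its complex eigenvalues. -/
def specRad {d : Type*} [Fintype d] [DecidableEq d] (M : Matrix d d ℝ) : ℝ≥0∞ :=
  spectralRadius ℂ (M.map (algebraMap ℝ ℂ))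

/-- Induced ∞-norm of a matrix: maximum absolute row sum. -/
def normInfM {d e : Type*} [Fintype d] [Fintype e] (M : Matrix d e ℝ) : ℝ :=
  ⨆ i, ∑ j, |M i j|

/-- Induced 1-norm of a matrix: maximum absolute column sum. -/
def normOneM {d e : Type*} [Fintype d] [Fintype e] (M : Matrix d e ℝ) : ℝ :=
  ⨆ j, ∑ i, |M i j|

/-- The `p`-norm of a finite-dimensional real vector, `1 ≤ p ≤ ∞`. -/
def vecPNorm {d : Type*} [Fintype d] (p : ℝ≥0∞) (v : d → ℝ) : ℝ :=
  if p = ⊤ then ⨆ i, |v i| else (∑ i, |v i| ^ p.toReal) ^ (1 / p.toReal)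

/-- The induced matrix `p`-norm `‖M‖_p = sup_{‖v‖_p = 1} ‖Mv‖_p`. -/
def inducedPNorm {d : Type*} [Fintype d] (p : ℝ≥0∞) (M : Matrix d d ℝ) : ℝ :=
  sSup {r | ∃ v : d → ℝ, vecPNorm p v = 1 ∧ r = vecPNorm p (M.mulVec v)}

/-- The operator norm of the Hankel operator of `f` on `ℓ²`. -/
def hankelOpNorm {S : Type*} (f : List S → ℝ) : ℝ :=
  sSup {r | ∃ g : List S → ℝ, (Summable fun y => g y ^ 2) ∧ (∑' y, g y ^ 2) ≤ 1 ∧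
    (Summable fun x : List S => (∑' y : List S, f (x ++ y) * g y) ^ 2) ∧
    r = Real.sqrt (∑' x : List S, (∑' y : List S, f (x ++ y) * g y) ^ 2)}

end

namespace WFA

variable {S : Type*} {n : ℕ}

lemma fwd_append_singleton (M : WFA S n) (x : List S) (a : S) :
    M.fwd (x ++ [a]) = M.fwd x ᵥ* M.trans a := by
  simp [fwd, matOf, Matrix.vecMul_vecMul]

lemma bwd_cons (M : WFA S n) (a : S) (s : List S) :
    M.bwd (a :: s) = M.trans a *ᵥ M.bwd s := by
  simp [bwd, matOf, Matrix.mulVec_mulVec]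

lemma f_eq_fwd_dotProduct (M : WFA S n) (x : List S) : M.f x = M.fwd x ⬝ᵥ M.final := by
  simp [f, fwd, Matrix.dotProduct_mulVec]

/-- The forward vector of a truncation, padded with zeros. -/
noncomputable def truncFwd (M : WFA S n) {m : ℕ} (h : m ≤ n) (x : List S) : Fin n → ℝ :=
  Function.extend (Fin.castLE h) ((M.trunc m h).fwd x) 0

lemma truncFwd_castLE (M : WFA S n) {m : ℕ} (h : m ≤ n) (x : List S) (i : Fin m) :
    M.truncFwd h x (Fin.castLE h i) = (M.trunc m h).fwd x i :=
  (Fin.castLE_injective h).extend_apply _ _ _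

lemma truncFwd_of_le (M : WFA S n) {m : ℕ} (h : m ≤ n) (x : List S) {i : Fin n}
    (hi : m ≤ (i : ℕ)) : M.truncFwd h x i = 0 := by
  refine Function.extend_apply' _ _ _ ?_
  rintro ⟨j, rfl⟩
  exact absurd j.isLt (not_lt.mpr hi)

lemma truncFwd_dotProduct (M : WFA S n) {m : ℕ} (h : m ≤ n) (x : List S) (c : Fin n → ℝ) :
    M.truncFwd h x ⬝ᵥ c = (M.trunc m h).fwd x ⬝ᵥ fun i => c (Fin.castLE h i) := by
  refine (Fintype.sum_of_injective (Fin.castLE h) (Fin.castLE_injective h) _ _ ?_ ?_).symm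
  · intro i hi
    simp [truncFwd, Function.extend_apply' _ _ _ hi]
  · intro i
    rw [truncFwd_castLE]

lemma truncFwd_append_singleton (M : WFA S n) {m : ℕ} (h : m ≤ n) (x : List S) (a : S)
    {i : Fin n} (hi : (i : ℕ) < m) :
    M.truncFwd h (x ++ [a]) i = (M.truncFwd h x ᵥ* M.trans a) i := by
  obtain ⟨j, rfl⟩ : ∃ j : Fin m, Fin.castLE h j = i := ⟨⟨i, hi⟩, rfl⟩
  rw [truncFwd_castLE, fwd_append_singleton]
  exact (M.truncFwd_dotProduct h x fun i => M.trans a i (Fin.castLE h j)).symm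

lemma truncFwd_nil (M : WFA S n) {m : ℕ} (h : m ≤ n) {i : Fin n} (hi : (i : ℕ) < m) :
    M.truncFwd h [] i = M.fwd [] i := by
  obtain ⟨j, rfl⟩ : ∃ j : Fin m, Fin.castLE h j = i := ⟨⟨i, hi⟩, rfl⟩
  simp [truncFwd_castLE, fwd, matOf, trunc]

lemma f_sub_trunc_f (M : WFA S n) {m : ℕ} (h : m ≤ n) (x : List S) :
    M.f x - (M.trunc m h).f x = (M.fwd x - M.truncFwd h x) ⬝ᵥ M.final := by
  rw [f_eq_fwd_dotProduct, f_eq_fwd_dotProduct, sub_dotProduct, truncFwd_dotProduct]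
  rfl

/-- If the backward columns are orthogonal with squared norms `d`, then the output energy of the
state `v` is `∑ i, d i * v i ^ 2`. -/
lemma hasSum_dotProduct_bwd_sq (M : WFA S n) {d : Fin n → ℝ}
    (hd : ∀ i j, HasSum (fun s => M.bwd s i * M.bwd s j) (if i = j then d i else 0))
    (v : Fin n → ℝ) : HasSum (fun s => (v ⬝ᵥ M.bwd s) ^ 2) (∑ i, d i * v i ^ 2) := by
  have h := hasSum_sum fun i (_ : i ∈ Finset.univ) =>
    hasSum_sum fun j (_ : j ∈ Finset.univ) => (hd i j).mul_left (v i * v j)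
  convert! h using 1
  · ext s
    rw [sq, dotProduct, Finset.sum_mul_sum]
    exact Finset.sum_congr rfl fun i _ => Finset.sum_congr rfl fun j _ => by ring
  · exact Finset.sum_congr rfl fun i _ => by simp; ring

/-- The observability Lyapunov inequality. -/
lemma sq_dotProduct_final_add_sum_le [Fintype S] (M : WFA S n) {d : Fin n → ℝ}
    (hd : ∀ i j, HasSum (fun s => M.bwd s i * M.bwd s j) (if i = j then d i else 0))
    (v : Fin n → ℝ) :
    (v ⬝ᵥ M.final) ^ 2 + ∑ a, ∑ i, d i * (v ᵥ* M.trans a) i ^ 2 ≤ ∑ i, d i * v i ^ 2 := by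
  have h0 : HasSum (fun _ : Unit => (v ⬝ᵥ M.bwd []) ^ 2) ((v ⬝ᵥ M.bwd []) ^ 2) := hasSum_unique _
  have hcons (a : S) : HasSum (fun s => (v ⬝ᵥ M.bwd (a :: s)) ^ 2)
      (∑ i, d i * (v ᵥ* M.trans a) i ^ 2) := by
    simpa only [bwd_cons, dotProduct_mulVec] using M.hasSum_dotProduct_bwd_sq hd (v ᵥ* M.trans a)
  have hall := M.hasSum_dotProduct_bwd_sq hd v
  let c : Unit ⊕ (Σ _ : S, List S) → List S := Sum.elim (fun _ => []) fun p => p.1 :: p.2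
  have hc : Function.Injective c := by
    rintro (_ | ⟨a, s⟩) (_ | ⟨b, t⟩) h <;> simp_all [c]
  have hsig : HasSum (fun p : Σ _ : S, List S => (v ⬝ᵥ M.bwd (p.1 :: p.2)) ^ 2)
      (∑ a, ∑ i, d i * (v ᵥ* M.trans a) i ^ 2) := by
    have hs : Summable fun p : Σ _ : S, List S => (v ⬝ᵥ M.bwd (p.1 :: p.2)) ^ 2 :=
      hall.summable.comp_injective (hc.comp Sum.inr_injective)
    exact (hs.hasSum.sigma hcons).unique (hasSum_fintype _) ▸ hs.hasSum
  have htot := HasSum.sum (f := fun y => (v ⬝ᵥ M.bwd (c y)) ^ 2) h0 hsig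
  have hnil : M.bwd [] = M.final := by simp [bwd, matOf]
  rw [hnil] at htot
  exact hasSum_le_inj c hc (fun _ _ => sq_nonneg _)
    (by rintro (_ | _) <;> exact le_rfl) htot hall

end WFA

/-- A telescoping bound over words: if `E` is a nonnegative potential whose total increase from a
word `x` to its one-letter extensions, plus `g x`, is at most the total of `P` over these
extensions, then `g` sums to at most the sum of `P`. -/
lemma summable_and_tsum_le_of_word_telescope {S : Type*} [Fintype S] {g E P : List S → ℝ}
    (hg : ∀ x, 0 ≤ g x) (hE : ∀ x, 0 ≤ E x) (hP : ∀ x, 0 ≤ P x) (hPs : Summable P)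
    (hnil : E [] ≤ P [])
    (hstep : ∀ x, g x + ∑ a, E (x ++ [a]) ≤ E x + ∑ a, P (x ++ [a])) :
    Summable g ∧ ∑' x, g x ≤ ∑' x, P x := by
  let L (h : List S → ℝ) (k : ℕ) : ℝ := ∑ t : Fin k → S, h (List.ofFn t)
  have hLnn {h : List S → ℝ} (hh : ∀ x, 0 ≤ h x) (k : ℕ) : 0 ≤ L h k :=
    Finset.sum_nonneg fun _ _ => hh _
  have hLsucc (h : List S → ℝ) (k : ℕ) :
      L h (k + 1) = ∑ t : Fin k → S, ∑ a, h (List.ofFn t ++ [a]) := by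
    rw [Finset.sum_comm,
      ← Fintype.sum_prod_type' fun (a : S) (t : Fin k → S) => h (List.ofFn t ++ [a])]
    refine (Fintype.sum_equiv (Fin.snocEquiv fun _ => S) _ _ fun p => ?_).symm
    rw [List.ofFn_succ']
    simp [Fin.snocEquiv, List.concat_eq_append]
  have hlevel (k : ℕ) : L g k + L E (k + 1) ≤ L E k + L P (k + 1) := by
    rw [hLsucc, hLsucc, ← Finset.sum_add_distrib, ← Finset.sum_add_distrib]
    exact Finset.sum_le_sum fun t _ => hstep _
  have hpartial (N : ℕ) :
      ∑ k ∈ Finset.range N, L g k + L E N ≤ ∑ k ∈ Finset.range (N + 1), L P k := by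
    induction N with
    | zero => simpa [L] using hnil
    | succ N ih =>
      rw [Finset.sum_range_succ, Finset.sum_range_succ _ (N + 1)]
      linarith [hlevel N]
  let e := (List.equivSigmaTuple (α := S)).symm
  have hPe : HasSum (fun p => P (e p)) (∑' x, P x) := e.hasSum_iff.mpr hPs.hasSum
  have hPL : HasSum (L P) (∑' x, P x) := hPe.sigma fun k => hasSum_fintype _
  have hbound (N : ℕ) : ∑ k ∈ Finset.range N, L g k ≤ ∑' x, P x := by
    have h1 := sum_le_hasSum (Finset.range (N + 1)) (fun k _ => hLnn hP k) hPL
    linarith [hpartial N, hLnn hE N]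
  have hgL := summable_of_sum_range_le (hLnn hg) hbound
  have hge : Summable fun p => g (e p) := by
    refine (summable_sigma_of_nonneg fun p => hg _).mpr ⟨fun k => Summable.of_finite, ?_⟩
    convert hgL using 2 with k
    exact tsum_fintype _
  have hgs : Summable g := e.summable_iff.mp hge
  have hgL' : HasSum (L g) (∑' x, g x) :=
    (e.hasSum_iff.mpr hgs.hasSum).sigma fun k => hasSum_fintype _
  refine ⟨hgs, ?_⟩
  rw [← hgL'.tsum_eq]
  exact Real.tsum_le_of_sum_range_le (hLnn hg) hbound

/-- the SVA truncation error bound: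
`‖f − f̂‖₂² ≤ σ_{n̂+1}² + ⋯ + σ_n²`. -/
theorem sva_truncation_error_bound {S : Type*} [Fintype S] {n : ℕ} (f : List S → ℝ)
    (hl2 : Summable fun x : List S => f x ^ 2)
    (hrank : ∀ m : ℕ, (∃ B : WFA S m, B.f = f) → n ≤ m)
    (A' : WFA S n) (hA'f : A'.f = f)
    (U V : List S → Fin n → ℝ) (σ : Fin n → ℝ)
    (hUsum : ∀ i j, Summable fun x : List S => U x i * U x j)
    (hVsum : ∀ i j, Summable fun x : List S => V x i * V x j)
    (hUorth : ∀ i j, (∑' x : List S, U x i * U x j) = if i = j then (1 : ℝ) else 0)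
    (hVorth : ∀ i j, (∑' x : List S, V x i * V x j) = if i = j then (1 : ℝ) else 0)
    (hσpos : ∀ i, 0 < σ i) (hσmono : ∀ i j : Fin n, i ≤ j → σ j ≤ σ i)
    (hsvd : ∀ p s : List S, f (p ++ s) = ∑ i : Fin n, U p i * σ i * V s i)
    (hfwd : ∀ p i, A'.fwd p i = U p i * Real.sqrt (σ i))
    (hbwd : ∀ s i, A'.bwd s i = V s i * Real.sqrt (σ i))
    (nh : ℕ) (hnh : nh < n) :
    (Summable fun x : List S => (f x - (A'.trunc nh hnh.le).f x) ^ 2) ∧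
      (∑' x : List S, (f x - (A'.trunc nh hnh.le).f x) ^ 2) ≤
        ∑ i ∈ Finset.univ.filter (fun i : Fin n => nh ≤ (i : ℕ)), σ i ^ 2 := by
  have hsq (i : Fin n) : √(σ i) * √(σ i) = σ i := Real.mul_self_sqrt (hσpos i).le
  have hd (i j : Fin n) :
      HasSum (fun s => A'.bwd s i * A'.bwd s j) (if i = j then σ i else 0) := by
    have h := ((hVsum i j).hasSum.mul_right (√(σ i) * √(σ j)))
    rw [hVorth] at h
    convert! h using 1
    · ext s
      rw [hbwd, hbwd]
      ring
    · split_ifs with hij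
      · rw [← hij, hsq, one_mul]
      · rw [zero_mul]
  have hz (i : Fin n) : HasSum (fun x => σ i * A'.fwd x i ^ 2) (σ i ^ 2) := by
    have h := (hUsum i i).hasSum.mul_right (σ i ^ 2)
    rw [hUorth, if_pos rfl, one_mul] at h
    convert! h using 2 with x
    rw [hfwd, mul_pow, sq √(σ i), hsq]
    ring
  set T := Finset.univ.filter fun i : Fin n => nh ≤ (i : ℕ)
  have hP : HasSum (fun x => ∑ i ∈ T, σ i * A'.fwd x i ^ 2) (∑ i ∈ T, σ i ^ 2) :=
    hasSum_sum fun i _ => hz i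
  set v : List S → Fin n → ℝ := fun x => A'.fwd x - A'.truncFwd hnh.le x with hv
  have hvtail (x : List S) (i : Fin n) (hi : nh ≤ (i : ℕ)) : v x i = A'.fwd x i := by
    simp [hv, A'.truncFwd_of_le hnh.le x hi]
  have hvhead (x : List S) (a : S) (i : Fin n) (hi : (i : ℕ) < nh) :
      v (x ++ [a]) i = (v x ᵥ* A'.trans a) i := by
    simp only [hv, Pi.sub_apply, sub_vecMul, A'.truncFwd_append_singleton hnh.le x a hi,
      A'.fwd_append_singleton]
  have hterm (i : Fin n) (r : ℝ) : 0 ≤ σ i * r ^ 2 := mul_nonneg (hσpos i).le (sq_nonneg r)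
  have key := summable_and_tsum_le_of_word_telescope
    (g := fun x => (v x ⬝ᵥ A'.final) ^ 2) (E := fun x => ∑ i, σ i * v x i ^ 2)
    (fun x => sq_nonneg _) (fun x => Finset.sum_nonneg fun i _ => hterm i _)
    (fun x => Finset.sum_nonneg fun i _ => hterm i _) hP.summable ?_ ?_
  · simpa only [← hA'f, A'.f_sub_trunc_f, ← hP.tsum_eq] using key
  · rw [Finset.sum_filter]
    refine Finset.sum_le_sum fun i _ => ?_
    split_ifs with hi
    · rw [hvtail _ _ hi]
    · simp [hv, A'.truncFwd_nil hnh.le (not_le.mp hi)]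
  · intro x
    have hext (a : S) : ∑ i, σ i * v (x ++ [a]) i ^ 2 ≤
        ∑ i, σ i * (v x ᵥ* A'.trans a) i ^ 2 + ∑ i ∈ T, σ i * A'.fwd (x ++ [a]) i ^ 2 := by
      rw [Finset.sum_filter, ← Finset.sum_add_distrib]
      refine Finset.sum_le_sum fun i _ => ?_
      split_ifs with hi
      · rw [hvtail _ _ hi]
        exact le_add_of_nonneg_left (hterm i _)
      · rw [hvhead _ _ _ (not_le.mp hi), add_zero]
    have hsum := Finset.sum_le_sum fun a (_ : a ∈ Finset.univ) => hext a
    rw [Finset.sum_add_distrib] at hsum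
    linarith [A'.sq_dotProduct_final_add_sum_le hd (v x)]
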